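/- Let H_0 be a search-cost distribution on [0, c̄] satisfying Assumption 1 with s*(H_0) < 1/c̄ (in particular H_0 is not the uniform distribution), and for λ ∈ [0,1] define the interpolation H_λ(c) := λ·(c/c̄) + (1 − λ)·H_0(c). Then each H_λ satisfies Assumption 1, s*(H_λ) = λ/c̄ + (1 − λ)·s*(H_0) is strictly increasing in λ on [0,1], the map λ ↦ a^M(H_λ) is nondecreasing on [0,1], and it is strictly increasing on the set of λ for which s*(H_λ) > 1/μ. -/

import Mathlib

open MeasureTheory Set Function Filter

noncomputable section

namespace CompSearch

def mean (F : ℝ → ℝ) : ℝ := ∫ t in (0:ℝ)..1, (1 - F t)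

def cInt (G : ℝ → ℝ) (x : ℝ) : ℝ := ∫ t in x..(1:ℝ), (1 - G t)

/-- The prior F with density f. -/
structure IsPrior (F f : ℝ → ℝ) : Prop where
  zero : ∀ x ≤ (0:ℝ), F x = 0
  one : ∀ x ≥ (1:ℝ), F x = 1
  smooth : ContDiffOn ℝ 2 F (Icc 0 1)
  deriv : ∀ x ∈ Icc (0:ℝ) 1, HasDerivWithinAt F (f x) (Icc 0 1) x
  fpos : ∀ x ∈ Icc (0:ℝ) 1, 0 < f x
  fcont : ContinuousOn f (Icc 0 1)

/-- A search-cost distribution given as a plain c.d.f. H with density h on [0, c̄]. -/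
structure IsCostD (H h : ℝ → ℝ) (cbar : ℝ) : Prop where
  cbar_pos : 0 < cbar
  zero : H 0 = 0
  one : H cbar = 1
  smooth : ContDiffOn ℝ 2 H (Icc 0 cbar)
  deriv : ∀ c ∈ Icc (0:ℝ) cbar, HasDerivWithinAt H (h c) (Icc 0 cbar) c
  hpos : ∀ c ∈ Icc (0:ℝ) cbar, 0 < h c

/-- Average density S(c) = H(c)/c, S(0) = h(0). -/
def Sfun (H h : ℝ → ℝ) (c : ℝ) : ℝ := if c = 0 then h 0 else H c / c

/-- minimal average density s*(H) = min_{c ∈ [0,c̄]} S(c). -/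
def sStar (H h : ℝ → ℝ) (cbar : ℝ) : ℝ := sInf (Sfun H h '' Icc 0 cbar)

/-- Assumption 1: the global minimum of S on [0,c̄] is attained at some c^M < c̄. -/
def Assumption1 (H h : ℝ → ℝ) (cbar : ℝ) : Prop :=
  ∃ cM ∈ Ico (0:ℝ) cbar, ∀ c ∈ Icc (0:ℝ) cbar, Sfun H h cM ≤ Sfun H h c

/-- Inverse of c_F on [0,1]. -/
def cFinv (F : ℝ → ℝ) (y : ℝ) : ℝ := Function.invFunOn (cInt F) (Icc 0 1) y

/-- The maximally informative threshold a^M(H). -/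
def aM (F H h : ℝ → ℝ) (cbar : ℝ) : ℝ :=
  if sStar H h cbar ≤ 1 / mean F then 0 else cFinv F (1 / sStar H h cbar)

/-- H₂ is a mean-preserving spread of H₁ on [0, c̄]. -/
def MPSpread (H1 H2 : ℝ → ℝ) (cbar : ℝ) : Prop :=
  (∀ x ∈ Icc (0:ℝ) cbar, (∫ t in (0:ℝ)..x, H1 t) ≤ ∫ t in (0:ℝ)..x, H2 t) ∧
  (∫ t in (0:ℝ)..cbar, H1 t) = ∫ t in (0:ℝ)..cbar, H2 t

/-- The density has at most finitely many local extrema: there is a finite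
partition of [0,c̄] on each piece of which it is monotone. -/
def FinitelyPiecewiseMono (h : ℝ → ℝ) (cbar : ℝ) : Prop :=
  ∃ (K : ℕ) (x : ℕ → ℝ), 0 < K ∧ x 0 = 0 ∧ x K = cbar ∧
    (∀ i < K, x i ≤ x (i + 1)) ∧
    ∀ i < K, MonotoneOn h (Icc (x i) (x (i + 1))) ∨ AntitoneOn h (Icc (x i) (x (i + 1)))


theorem IsPrior.lt_one {F f : ℝ → ℝ} (hF : IsPrior F f) {x : ℝ} (hx : x ∈ Ico (0:ℝ) 1) :
    F x < 1 := by
  have hmono : StrictMonoOn F (Icc 0 1) := by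
    refine strictMonoOn_of_hasDerivWithinAt_pos (convex_Icc 0 1) hF.smooth.continuousOn
      (f' := f) (fun y hy => ?_) fun y hy => hF.fpos y (interior_subset hy)
    exact (hF.deriv y (interior_subset hy)).mono interior_subset
  simpa [hF.one 1 le_rfl] using hmono ⟨hx.1, hx.2.le⟩ (right_mem_Icc.2 zero_le_one) hx.2

theorem IsPrior.intervalIntegrable {F f : ℝ → ℝ} (hF : IsPrior F f) {x y : ℝ}
    (hx : x ∈ Icc (0:ℝ) 1) (hy : y ∈ Icc (0:ℝ) 1) :
    IntervalIntegrable (fun t => 1 - F t) volume x y :=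
  ((continuousOn_const.sub hF.smooth.continuousOn).mono
    (uIcc_subset_Icc hx hy)).intervalIntegrable

theorem IsPrior.strictAntiOn_cInt {F f : ℝ → ℝ} (hF : IsPrior F f) :
    StrictAntiOn (cInt F) (Icc 0 1) := by
  intro x hx y hy hxy
  have hpos : 0 < ∫ t in x..y, (1 - F t) :=
    intervalIntegral.intervalIntegral_pos_of_pos_on (hF.intervalIntegrable hx hy)
      (fun t ht => sub_pos.2 (hF.lt_one ⟨hx.1.trans ht.1.le, ht.2.trans_le hy.2⟩)) hxy
  have hadd := intervalIntegral.integral_add_adjacent_intervals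
    (hF.intervalIntegrable hx hy) (hF.intervalIntegrable hy (right_mem_Icc.2 zero_le_one))
  unfold cInt
  linarith

theorem IsPrior.continuousOn_cInt {F f : ℝ → ℝ} (hF : IsPrior F f) :
    ContinuousOn (cInt F) (Icc 0 1) := by
  have h := intervalIntegral.continuousOn_primitive_interval_left (μ := volume)
    (f := fun t => 1 - F t) (a := 0) (b := 1)
    ((continuousOn_const.sub hF.smooth.continuousOn).integrableOn_Icc.mono_set
      (uIcc_of_le zero_le_one).subset)
  rwa [uIcc_of_le zero_le_one] at h

theorem IsPrior.mem_image_cInt {F f : ℝ → ℝ} (hF : IsPrior F f) {y : ℝ}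
    (hy : y ∈ Icc 0 (mean F)) : y ∈ cInt F '' Icc 0 1 := by
  have h := intermediate_value_Icc' zero_le_one hF.continuousOn_cInt
  have h1 : cInt F 1 = 0 := intervalIntegral.integral_same
  rw [h1] at h
  exact h hy

theorem IsPrior.cFinv_mem {F f : ℝ → ℝ} (hF : IsPrior F f) {y : ℝ}
    (hy : y ∈ Icc 0 (mean F)) : cFinv F y ∈ Icc (0:ℝ) 1 :=
  invFunOn_mem (hF.mem_image_cInt hy)

theorem IsPrior.cInt_cFinv {F f : ℝ → ℝ} (hF : IsPrior F f) {y : ℝ}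
    (hy : y ∈ Icc 0 (mean F)) : cInt F (cFinv F y) = y :=
  invFunOn_eq (hF.mem_image_cInt hy)

theorem IsPrior.strictAntiOn_cFinv {F f : ℝ → ℝ} (hF : IsPrior F f) :
    StrictAntiOn (cFinv F) (Icc 0 (mean F)) := by
  intro x hx y hy hxy
  rw [← hF.strictAntiOn_cInt.lt_iff_gt (hF.cFinv_mem hx) (hF.cFinv_mem hy)]
  rwa [hF.cInt_cFinv hx, hF.cInt_cFinv hy]

theorem one_div_mem_Icc {m s : ℝ} (hm : 0 < m) (hs : 1 / m < s) : 1 / s ∈ Icc 0 m := by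
  have hs0 : 0 < s := (one_div_pos.2 hm).trans hs
  exact ⟨(one_div_pos.2 hs0).le, ((one_div_lt hm hs0).1 hs).le⟩

theorem IsPrior.aM_nonneg {F f : ℝ → ℝ} (hF : IsPrior F f) (hm : 0 < mean F)
    (H h : ℝ → ℝ) (cbar : ℝ) : 0 ≤ aM F H h cbar := by
  unfold aM
  split_ifs with hs
  · exact le_rfl
  · exact (hF.cFinv_mem (one_div_mem_Icc hm (not_le.1 hs))).1

theorem IsPrior.aM_lt_aM {F f : ℝ → ℝ} (hF : IsPrior F f) (hm : 0 < mean F)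
    {H₁ h₁ H₂ h₂ : ℝ → ℝ} {cbar : ℝ} (hs₁ : 1 / mean F < sStar H₁ h₁ cbar)
    (hs : sStar H₁ h₁ cbar < sStar H₂ h₂ cbar) : aM F H₁ h₁ cbar < aM F H₂ h₂ cbar := by
  have hs₂ := hs₁.trans hs
  rw [aM, aM, if_neg hs₁.not_ge, if_neg hs₂.not_ge]
  exact hF.strictAntiOn_cFinv (one_div_mem_Icc hm hs₂) (one_div_mem_Icc hm hs₁)
    (one_div_lt_one_div_of_lt ((one_div_pos.2 hm).trans hs₁) hs)

theorem sStar_eq_of_forall_le {H h : ℝ → ℝ} {cbar c : ℝ} (hc : c ∈ Icc 0 cbar)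
    (hmin : ∀ x ∈ Icc 0 cbar, Sfun H h c ≤ Sfun H h x) : sStar H h cbar = Sfun H h c :=
  IsLeast.csInf_eq ⟨mem_image_of_mem _ hc, forall_mem_image.2 hmin⟩

/-- For H₀ satisfying Assumption 1 with s*(H₀) < 1/c̄, the interpolations
H_λ = λ·U[0,c̄] + (1−λ)·H₀ all satisfy Assumption 1, s*(H_λ) = λ/c̄ + (1−λ)·s*(H₀) is
strictly increasing in λ, λ ↦ a^M(H_λ) is nondecreasing, and strictly increasing where
s*(H_λ) > 1/μ. -/
theorem interpolation_towards_uniform_increases_informativeness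
    (F f : ℝ → ℝ) (hF : IsPrior F f)
    (H0 h0 : ℝ → ℝ) (cbar : ℝ) (hH0 : IsCostD H0 h0 cbar)
    (hcbar : cbar < mean F)
    (hA0 : Assumption1 H0 h0 cbar)
    (hs0 : sStar H0 h0 cbar < 1 / cbar)
    (Hl hl : ℝ → ℝ → ℝ)
    (hHl : ∀ lam c : ℝ, Hl lam c = lam * (c / cbar) + (1 - lam) * H0 c)
    (hhl : ∀ lam c : ℝ, hl lam c = lam * (1 / cbar) + (1 - lam) * h0 c) :
    (∀ lam ∈ Icc (0:ℝ) 1, Assumption1 (Hl lam) (hl lam) cbar) ∧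
    (∀ lam ∈ Icc (0:ℝ) 1,
      sStar (Hl lam) (hl lam) cbar = lam / cbar + (1 - lam) * sStar H0 h0 cbar) ∧
    StrictMonoOn (fun lam => sStar (Hl lam) (hl lam) cbar) (Icc (0:ℝ) 1) ∧
    MonotoneOn (fun lam => aM F (Hl lam) (hl lam) cbar) (Icc (0:ℝ) 1) ∧
    (∀ lam1 ∈ Icc (0:ℝ) 1, ∀ lam2 ∈ Icc (0:ℝ) 1, lam1 < lam2 →
      1 / mean F < sStar (Hl lam1) (hl lam1) cbar →
      aM F (Hl lam1) (hl lam1) cbar < aM F (Hl lam2) (hl lam2) cbar) := by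
  have hS : ∀ lam c, Sfun (Hl lam) (hl lam) c = lam / cbar + (1 - lam) * Sfun H0 h0 c := by
    intro lam c
    unfold Sfun
    split_ifs with hc
    · rw [hhl, mul_one_div]
    · rw [hHl]
      field_simp
  have hm : 0 < mean F := hH0.cbar_pos.trans hcbar
  obtain ⟨cM, hcM, hmin⟩ := hA0
  have hcM' : cM ∈ Icc 0 cbar := Ico_subset_Icc_self hcM
  have hmin_l : ∀ lam ∈ Icc (0:ℝ) 1, ∀ c ∈ Icc (0:ℝ) cbar,
      Sfun (Hl lam) (hl lam) cM ≤ Sfun (Hl lam) (hl lam) c := by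
    intro lam hlam c hc
    rw [hS, hS]
    have := mul_le_mul_of_nonneg_left (hmin c hc) (sub_nonneg.2 hlam.2)
    linarith
  have hs : ∀ lam ∈ Icc (0:ℝ) 1,
      sStar (Hl lam) (hl lam) cbar = lam / cbar + (1 - lam) * sStar H0 h0 cbar := by
    intro lam hlam
    rw [sStar_eq_of_forall_le hcM' (hmin_l lam hlam), sStar_eq_of_forall_le hcM' hmin, hS]
  have hstrict : StrictMonoOn (fun lam => sStar (Hl lam) (hl lam) cbar) (Icc (0:ℝ) 1) := by
    intro a ha b hb hab
    simp only [hs a ha, hs b hb]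
    rw [div_eq_mul_one_div a, div_eq_mul_one_div b]
    nlinarith [mul_pos (sub_pos.2 hab) (sub_pos.2 hs0)]
  refine ⟨fun lam hlam => ⟨cM, hcM, hmin_l lam hlam⟩, hs, hstrict, ?_,
    fun a ha b hb hab hsa => hF.aM_lt_aM hm hsa (hstrict ha hb hab)⟩
  refine monotoneOn_iff_forall_lt.2 fun a ha b hb hab => ?_
  by_cases hsa : sStar (Hl a) (hl a) cbar ≤ 1 / mean F
  · have ha0 : aM F (Hl a) (hl a) cbar = 0 := if_pos hsa
    exact ha0.trans_le (hF.aM_nonneg hm _ _ _)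
  · exact (hF.aM_lt_aM hm (not_le.1 hsa) (hstrict ha hb hab)).le

end CompSearch
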